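/- Let 𝐈 ∈ Subsets(r,n,s). If edim 𝐈 ≥ 0 and kdim 𝐈 ∈ {0, r}, then 𝐈 is intersecting. -/

import Mathlib

open Module

noncomputable section

/-- A complete flag on `ℂ^m`: an increasing family of subspaces with
`dim (F i) = i + 1` (`0`-based indexing, so `F i` is the `i+1`-st step). -/
structure Flagg (m : ℕ) where
  F : Fin m → Submodule ℂ (Fin m → ℂ)
  mono : Monotone F
  rank_eq : ∀ i : Fin m, finrank ℂ (F i) = (i : ℕ) + 1

/-- An `s`-tuple `J` of (strictly increasing) maps `[d] → [r]` is *intersecting* if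
for every `s`-tuple of complete flags on `ℂ^r` the corresponding intersection of
Schubert varieties in the Grassmannian `Gr(d, ℂ^r)` is nonempty. -/
def Intersecting {s d r : ℕ} (J : Fin s → Fin d → Fin r) : Prop :=
  ∀ F : Fin s → Flagg r, ∃ V : Submodule ℂ (Fin r → ℂ), finrank ℂ V = d ∧
    ∀ (l : Fin s) (k : Fin d), (k : ℕ) + 1 ≤ finrank ℂ ↥(V ⊓ (F l).F (J l k))

/-- `dim I = ∑_j (I(j) - j)`. -/
def dimI {d r : ℕ} (J : Fin d → Fin r) : ℤ := ∑ k, ((J k : ℤ) - (k : ℤ))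

/-- Expected dimension of a tuple `J ∈ Subsets(d,r,s)`. -/
def edim {s d r : ℕ} (J : Fin s → Fin d → Fin r) : ℤ :=
  (d : ℤ) * ((r : ℤ) - (d : ℤ)) - ∑ l, ((d : ℤ) * ((r : ℤ) - (d : ℤ)) - dimI (J l))

/-- `dim` for raw `ℕ`-valued increasing sequences. -/
def dimN {d : ℕ} (f : Fin d → ℕ) : ℤ := ∑ k, ((f k : ℤ) - (k : ℤ))

/-- Expected dimension for raw `ℕ`-valued tuples, with ambient dimension `n` explicit. -/
def edimN {s d : ℕ} (n : ℕ) (f : Fin s → Fin d → ℕ) : ℤ :=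
  (d : ℤ) * ((n : ℤ) - (d : ℤ)) - ∑ l, ((d : ℤ) * ((n : ℤ) - (d : ℤ)) - dimN (f l))

/-- `T(Λ) = ∑_l ∑_j Λ_l(j)`. -/
def TT {s r : ℕ} (Λ : Fin s → Fin r → ℝ) : ℝ := ∑ l, ∑ j, Λ l j

/-- `T_J(Λ) = ∑_l ∑_{j ∈ J_l} Λ_l(j)`. -/
def TJ {s d r : ℕ} (J : Fin s → Fin d → Fin r) (Λ : Fin s → Fin r → ℝ) : ℝ :=
  ∑ l, ∑ k, Λ l (J l k)

/-- `Γ(J)_l(k) = k - J_l(k) + (r - d)`, a weakly decreasing real `d`-tuple. -/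
def GammaT {s d r : ℕ} (J : Fin s → Fin d → Fin r) : Fin s → Fin d → ℝ :=
  fun l k => (k : ℝ) - (J l k : ℝ) + ((r : ℝ) - (d : ℝ))

/-- Membership of `(Λ, t)` in the Kirwan cone `𝒦(r,s)`: each `Λ_l` is weakly
decreasing and there are Hermitian matrices `A_1, …, A_s` summing to `t·I_r`
whose decreasingly-ordered spectra are the `Λ_l`. -/
def KirwanMem {s r : ℕ} (Λ : Fin s → Fin r → ℝ) (t : ℝ) : Prop :=
  (∀ l, Antitone (Λ l)) ∧
  ∃ (A : Fin s → Matrix (Fin r) (Fin r) ℂ) (hA : ∀ l, (A l).IsHermitian),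
    (∑ l, A l) = (t : ℂ) • (1 : Matrix (Fin r) (Fin r) ℂ) ∧
    ∀ l, ∃ e : Equiv.Perm (Fin r), ∀ i, Λ l i = (hA l).eigenvalues (e i)

/-- The subspace of a flag with `k` elements (so `flagAt G 0 = ⊥`). -/
def flagAt {m : ℕ} (G : Flagg m) : ℕ → Submodule ℂ (Fin m → ℂ)
  | 0 => ⊥
  | (k + 1) => if h : k < m then G.F ⟨k, h⟩ else ⊤

/-- The space `ℒ_I(F,G)` of linear maps `φ : ℂ^r → ℂ^q` with
`φ(F_l(j)) ⊆ G_l(I_l(j) - j)` for all `l, j`. -/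
def LSpace {s r q : ℕ} (I : Fin s → Fin r → ℕ) (F : Fin s → Flagg r) (G : Fin s → Flagg q) :
    Submodule ℂ ((Fin r → ℂ) →ₗ[ℂ] (Fin q → ℂ)) where
  carrier := {φ | ∀ (l : Fin s) (j : Fin r), ∀ v ∈ (F l).F j,
    φ v ∈ flagAt (G l) (I l j - (j : ℕ))}
  add_mem' := by
    intro a b ha hb l j v hv
    simpa using add_mem (ha l j v hv) (hb l j v hv)
  zero_mem' := by
    intro l j v hv
    simp
  smul_mem' := by
    intro c a ha l j v hv
    simpa using Submodule.smul_mem _ c (ha l j v hv)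

/-- The true dimension `tdim I`, for a raw tuple `I ∈ Subsets(r, r + q, s)`
(here `q = n - r`). -/
def tdim {s : ℕ} (r q : ℕ) (I : Fin s → Fin r → ℕ) : ℕ :=
  sInf {m : ℕ | ∃ (F : Fin s → Flagg r) (G : Fin s → Flagg q), finrank ℂ (LSpace I F G) = m}

/-- The kernel dimension `kdim I`. -/
def kdim {s : ℕ} (r q : ℕ) (I : Fin s → Fin r → ℕ) : ℕ :=
  sInf {m : ℕ | ∃ (F : Fin s → Flagg r) (G : Fin s → Flagg q)
      (φ : (Fin r → ℂ) →ₗ[ℂ] (Fin q → ℂ)), φ ∈ LSpace I F G ∧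
      finrank ℂ (LSpace I F G) = tdim r q I ∧ finrank ℂ (LinearMap.ker φ) = m}

/-- The (`0`-based) Schubert position of a subspace `W` w.r.t. a flag:
`posN Fl W k` is the least `j` with `dim (Fl(j) ⊓ W) = k + 1`. -/
def posN {m : ℕ} (Fl : Flagg m) (W : Submodule ℂ (Fin m → ℂ)) (k : ℕ) : ℕ :=
  sInf {j : ℕ | ∃ h : j < m, finrank ℂ ↥(Fl.F ⟨j, h⟩ ⊓ W) = k + 1}

/-- The (`0`-based, `ℕ`-valued) kernel position `kPos(I)_l(k)`. -/
def kPosFun {s : ℕ} (r q : ℕ) (I : Fin s → Fin r → ℕ) (l : Fin s) (k : ℕ) : ℕ :=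
  sInf {p : ℕ | ∃ (F : Fin s → Flagg r) (G : Fin s → Flagg q)
      (φ : (Fin r → ℂ) →ₗ[ℂ] (Fin q → ℂ)), φ ∈ LSpace I F G ∧
      finrank ℂ (LSpace I F G) = tdim r q I ∧
      finrank ℂ (LinearMap.ker φ) = kdim r q I ∧ posN (F l) (LinearMap.ker φ) k = p}

/-- Apply an `r`-tuple of reals at a natural index (junk value `0` out of range). -/
def applyI {r : ℕ} (f : Fin r → ℝ) (j : ℕ) : ℝ := if h : j < r then f ⟨j, h⟩ else 0

/-- Apply an `r`-tuple of naturals at a natural index (junk value `0` out of range). -/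
def applyN {r : ℕ} (f : Fin r → ℕ) (j : ℕ) : ℕ := if h : j < r then f ⟨j, h⟩ else 0

/-- The slope `slope_θ(J) = (1/d) ∑_l ∑_{j ∈ J_l} θ_l(j)` of a tuple. -/
def slopeT {s d r : ℕ} (θ : Fin s → Fin r → ℝ) (J : Fin s → Fin d → Fin r) : ℝ :=
  ((d : ℝ))⁻¹ * ∑ l, ∑ k, θ l (J l k)

/-- The slope `slope_θ(W, F) = slope_θ(Pos(W, F))` of a (nonzero) subspace. -/
def slopeW {s r : ℕ} (θ : Fin s → Fin r → ℝ) (F : Fin s → Flagg r)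
    (W : Submodule ℂ (Fin r → ℂ)) : ℝ :=
  ((finrank ℂ W : ℝ))⁻¹ * ∑ l, ∑ k ∈ Finset.range (finrank ℂ W), applyI (θ l) (posN (F l) W k)

end


section GenericSurj
open MvPolynomial Topology

lemma nhds_or_of_constructible {X : Type*} [TopologicalSpace X] (ξ : X)
    (hξ : ∀ U : Set X, IsOpen U → U.Nonempty → ξ ∈ U) {S : Set X}
    (hS : Topology.IsConstructible S) : S ∈ 𝓝 ξ ∨ Sᶜ ∈ 𝓝 ξ := by
  induction hS using Topology.IsConstructible.empty_union_induction with
  | open_retrocompact U hU _ =>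
    rcases U.eq_empty_or_nonempty with h | h
    · right; simp [h]
    · left; exact hU.mem_nhds (hξ U hU h)
  | union s _ t _ h1 h2 =>
    rcases h1 with h1 | h1
    · left; exact Filter.mem_of_superset h1 Set.subset_union_left
    · rcases h2 with h2 | h2
      · left; exact Filter.mem_of_superset h2 Set.subset_union_right
      · right; rw [Set.compl_union]; exact Filter.inter_mem h1 h2
  | compl s _ h => rw [compl_compl]; exact h.symm

lemma exists_generic_preimage {X Y : Type} [Finite X] [Finite Y]
    (f : Y → MvPolynomial X ℂ) (hf : Function.Injective (aeval f : MvPolynomial Y ℂ →ₐ[ℂ] MvPolynomial X ℂ)) :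
    ∃ g : MvPolynomial Y ℂ, g ≠ 0 ∧ ∀ y : Y → ℂ, eval y g ≠ 0 →
      ∃ x : X → ℂ, ∀ i, eval x (f i) = y i := by
  classical
  set F : MvPolynomial Y ℂ →+* MvPolynomial X ℂ := (aeval f : MvPolynomial Y ℂ →ₐ[ℂ] MvPolynomial X ℂ).toRingHom with hF
  have hfp : F.FinitePresentation := by
    apply RingHom.FinitePresentation.of_finiteType.1
    have : (F.comp (algebraMap ℂ (MvPolynomial Y ℂ))).FiniteType := by
      have h0 : F.comp (algebraMap ℂ (MvPolynomial Y ℂ)) = algebraMap ℂ (MvPolynomial X ℂ) :=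
        (aeval f : MvPolynomial Y ℂ →ₐ[ℂ] MvPolynomial X ℂ).comp_algebraMap
      rw [h0]
      exact RingHom.finiteType_algebraMap.2 inferInstance
    exact RingHom.FiniteType.of_comp_finiteType this
  have hcon := PrimeSpectrum.isConstructible_range_comap hfp
  let ξ : PrimeSpectrum (MvPolynomial Y ℂ) := ⟨⊥, Ideal.isPrime_bot⟩
  have hgen : ∀ U : Set (PrimeSpectrum (MvPolynomial Y ℂ)), IsOpen U → U.Nonempty → ξ ∈ U := by
    rintro U hU ⟨p, hp⟩
    have : ξ ⤳ p := (PrimeSpectrum.le_iff_specializes _ _).1 (bot_le (a := p.asIdeal))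
    exact this.mem_open hU hp
  have hmem : ξ ∈ Set.range (PrimeSpectrum.comap F) := by
    refine ⟨⟨⊥, Ideal.isPrime_bot⟩, ?_⟩
    apply PrimeSpectrum.ext
    change Ideal.comap F ⊥ = ⊥
    exact (RingHom.injective_iff_ker_eq_bot F).1 hf
  have hnh : Set.range (PrimeSpectrum.comap F) ∈ 𝓝 ξ := by
    rcases nhds_or_of_constructible ξ hgen hcon with h | h
    · exact h
    · exact absurd hmem (mem_of_mem_nhds h)
  obtain ⟨_, ⟨_, ⟨g, rfl⟩, rfl⟩, hg1, hg2⟩ :=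
    PrimeSpectrum.isBasis_basic_opens.mem_nhds_iff.1 hnh
  refine ⟨g, ?_, ?_⟩
  · rintro rfl
    simp at hg1
  intro y hy
  have hmax : (vanishingIdeal ℂ {y} : Ideal (MvPolynomial Y ℂ)).IsMaximal :=
    isMaximal_iff_eq_vanishingIdeal_singleton.2 ⟨y, rfl⟩
  have : (⟨vanishingIdeal ℂ {y}, hmax.isPrime⟩ : PrimeSpectrum (MvPolynomial Y ℂ)) ∈ Set.range (PrimeSpectrum.comap F) := by
    apply hg2
    change g ∉ _
    simpa [mem_vanishingIdeal_singleton_iff, aeval_eq_eval] using hy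
  obtain ⟨p, hp⟩ := this
  obtain ⟨M, hM, hpM⟩ := Ideal.exists_le_maximal p.asIdeal p.isPrime.ne_top
  obtain ⟨x, rfl⟩ := isMaximal_iff_eq_vanishingIdeal_singleton.1 hM
  refine ⟨x, fun i => ?_⟩
  have h1 : MvPolynomial.X i - C (y i) ∈ (vanishingIdeal ℂ {y} : Ideal (MvPolynomial Y ℂ)) := by
    simp
  have h2 : F (MvPolynomial.X i - C (y i)) ∈ p.asIdeal := by
    have := congrArg PrimeSpectrum.asIdeal hp
    change Ideal.comap F p.asIdeal = vanishingIdeal ℂ {y} at this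
    rw [← this] at h1
    exact h1
  have h3 := hpM h2
  rw [mem_vanishingIdeal_singleton_iff] at h3
  simp [hF, aeval_eq_eval, sub_eq_zero] at h3
  simpa using h3

lemma eq_zero_of_vanish_open {Y : Type} [Finite Y] (P : MvPolynomial Y ℂ) (U : Set (Y → ℂ))
    (hU : IsOpen U) (hne : U.Nonempty) (h : ∀ y ∈ U, eval y P = 0) : P = 0 := by
  have := Fintype.ofFinite Y
  obtain ⟨y0, hy0⟩ := hne
  obtain ⟨ε, hε, hb⟩ := Metric.isOpen_iff.1 hU y0 hy0
  refine funext_set (fun i => Metric.ball (y0 i) ε) (fun i => ?_) (fun x hx => ?_)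
  · apply infinite_of_mem_nhds (y0 i) (Metric.ball_mem_nhds _ hε)
  · rw [map_zero]
    apply h; apply hb
    rw [Metric.mem_ball, dist_pi_lt_iff hε]
    intro i; exact hx i trivial

lemma eval_aeval_eq {X Y : Type} (f : Y → MvPolynomial X ℂ) (x : X → ℂ) (P : MvPolynomial Y ℂ) :
    eval x (aeval f P) = eval (fun y => eval x (f y)) P := by
  induction P using MvPolynomial.induction_on with
  | C a => simp [algebraMap_eq]
  | add p q hp hq => rw [map_add, map_add, hp, hq, map_add]
  | mul_X p i hp => rw [map_mul, map_mul, hp, aeval_X, map_mul, eval_X]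

theorem dense_range_of_deriv {X Y : Type} [Fintype X] [Fintype Y]
    (f : Y → MvPolynomial X ℂ) (x0 : X → ℂ)
    (hd : ∀ z : Y → ℂ, ∃ v : X → ℂ,
      HasDerivAt (fun t : ℂ => fun y => eval (x0 + t • v) (f y)) z 0) :
    Dense (Set.range (fun (x : X → ℂ) (y : Y) => eval x (f y))) := by
  set Φ : (X → ℂ) → (Y → ℂ) := fun (x : X → ℂ) (y : Y) => eval x (f y) with hΦ
  have han : AnalyticAt ℂ Φ x0 := by
    rw [analyticAt_pi_iff]
    intro y
    have := AnalyticOnNhd.eval_continuousLinearMap (ContinuousLinearMap.id ℂ (X → ℂ)) (f y)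
    exact this x0 trivial
  have hs : HasStrictFDerivAt Φ (fderiv ℂ Φ x0) x0 := han.hasStrictFDerivAt
  have hsurj : (fderiv ℂ Φ x0).range = ⊤ := by
    rw [LinearMap.range_eq_top]
    intro z
    obtain ⟨v, hv⟩ := hd z
    refine ⟨v, ?_⟩
    have h1 : HasDerivAt (fun t : ℂ => x0 + t • v) v 0 := by
      simpa using ((hasDerivAt_id (0:ℂ)).smul_const v).const_add x0
    have h2 : HasFDerivAt Φ (fderiv ℂ Φ x0) (x0 + (0:ℂ) • v) := by
      simpa using hs.hasFDerivAt
    have h3 := h2.comp_hasDerivAt (0:ℂ) h1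
    exact h3.unique hv
  have hmap := hs.map_nhds_eq_of_surj hsurj
  have hinj : Function.Injective (aeval f : MvPolynomial Y ℂ →ₐ[ℂ] MvPolynomial X ℂ) := by
    rw [injective_iff_map_eq_zero]
    intro P hP
    have hr : Set.range Φ ∈ 𝓝 (Φ x0) := by
      rw [← hmap]; exact Filter.range_mem_map
    obtain ⟨U, hUr, hU, hxU⟩ := mem_nhds_iff.1 hr
    refine eq_zero_of_vanish_open P U hU ⟨_, hxU⟩ (fun y hy => ?_)
    obtain ⟨x, rfl⟩ := hUr hy
    have := congrArg (eval x) hP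
    rw [map_zero] at this
    rw [← this, hΦ, eval_aeval_eq]
  obtain ⟨g, hg0, hg⟩ := exists_generic_preimage f hinj
  rw [dense_iff_inter_open]
  intro U hU hne
  by_contra hcon
  apply hg0
  refine eq_zero_of_vanish_open g U hU hne (fun y hy => ?_)
  by_contra hy'
  obtain ⟨x, hx⟩ := hg y hy'
  exact hcon ⟨y, hy, x, funext hx⟩

end GenericSurj


section Density
open MvPolynomial Matrix Topology

lemma expand_triple {R : Type*} [Ring R] [Algebra ℂ R] (t : ℂ) (h U m b : R) :
    (1 + t • h) * (U + t • m) * (1 + t • b) =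
      U + t • (m + h * U + U * b) + t ^ 2 • (h * m + h * U * b + m * b)
          + t ^ 3 • (h * m * b) := by
  simp only [add_mul, mul_add, one_mul, mul_one, smul_mul_assoc, mul_smul_comm, smul_add, smul_smul,
    pow_succ, pow_zero, one_mul]
  module

lemma hasDerivAt_cubic (a b c d : ℂ) :
    HasDerivAt (fun t : ℂ => a + t * b + t ^ 2 * c + t ^ 3 * d) b 0 := by
  have h1 := (((hasDerivAt_id (0:ℂ)).mul_const b).const_add a)
  have h2 := ((hasDerivAt_pow 2 (0:ℂ)).mul_const c)
  have h3 := ((hasDerivAt_pow 3 (0:ℂ)).mul_const d)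
  have := (h1.add h2).add h3
  exact this.congr_deriv (by norm_num)

theorem dense_param {s r q n : ℕ} (d : Fin s → Fin r → ℕ) (σ : Fin s → (Fin r ⊕ Fin q) ≃ Fin n)
    (hσ : ∀ l (i : Fin q) j, (i : ℕ) < d l j → σ l (Sum.inr i) ≤ σ l (Sum.inl j))
    (A : Fin s → Matrix (Fin r) (Fin r) ℂ) (B B' : Fin s → Matrix (Fin q) (Fin q) ℂ)
    (hB : ∀ l, B l * B' l = 1)
    (hT : ∀ w : Fin s → Matrix (Fin q) (Fin r) ℂ, ∃ η : Matrix (Fin q) (Fin r) ℂ,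
      ∀ l (i : Fin q) j, d l j ≤ (i : ℕ) → (B' l * η * A l) i j = w l i j) :
    Dense {g : Fin s × (Fin r ⊕ Fin q) × (Fin r ⊕ Fin q) → ℂ |
      ∃ (η : Matrix (Fin q) (Fin r) ℂ) (U β : Fin s → Matrix (Fin r ⊕ Fin q) (Fin r ⊕ Fin q) ℂ),
        (∀ l i j, U l (Sum.inr i) (Sum.inl j) = 0) ∧
        (∀ l c c', ¬ (σ l c ≤ σ l c') → β l c c' = 0) ∧
        ∀ l a b, g (l, a, b) = ((fromBlocks 1 0 η 1 : Matrix (Fin r ⊕ Fin q) (Fin r ⊕ Fin q) ℂ) * U l * β l) a b} := by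
  classical
  let V := (Fin q × Fin r) ⊕ ((Fin s × (Fin r ⊕ Fin q) × (Fin r ⊕ Fin q)) ⊕ (Fin s × (Fin r ⊕ Fin q) × (Fin r ⊕ Fin q)))
  -- evaluation of the parameters
  let et : (V → ℂ) → Matrix (Fin q) (Fin r) ℂ := fun x => Matrix.of fun i j => x (Sum.inl (i, j))
  let Ut : (V → ℂ) → Fin s → Matrix (Fin r ⊕ Fin q) (Fin r ⊕ Fin q) ℂ := fun x l => Matrix.of fun a b =>
    if a.isRight ∧ b.isLeft then 0 else x (Sum.inr (Sum.inl (l, a, b)))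
  let bt : (V → ℂ) → Fin s → Matrix (Fin r ⊕ Fin q) (Fin r ⊕ Fin q) ℂ := fun x l => Matrix.of fun a b =>
    if σ l a ≤ σ l b then x (Sum.inr (Sum.inr (l, a, b))) else 0
  let ep : Matrix (Fin q) (Fin r) (MvPolynomial V ℂ) := Matrix.of fun i j => X (Sum.inl (i, j))
  let Up : Fin s → Matrix (Fin r ⊕ Fin q) (Fin r ⊕ Fin q) (MvPolynomial V ℂ) := fun l => Matrix.of fun a b =>
    if a.isRight ∧ b.isLeft then 0 else X (Sum.inr (Sum.inl (l, a, b)))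
  let bp : Fin s → Matrix (Fin r ⊕ Fin q) (Fin r ⊕ Fin q) (MvPolynomial V ℂ) := fun l => Matrix.of fun a b =>
    if σ l a ≤ σ l b then X (Sum.inr (Sum.inr (l, a, b))) else 0
  let f : Fin s × (Fin r ⊕ Fin q) × (Fin r ⊕ Fin q) → MvPolynomial V ℂ := fun y =>
    ((fromBlocks 1 0 ep 1 : Matrix (Fin r ⊕ Fin q) (Fin r ⊕ Fin q) (MvPolynomial V ℂ)) * Up y.1 * bp y.1) y.2.1 y.2.2
  have hev : ∀ (x : V → ℂ) y, eval x (f y) = ((fromBlocks 1 0 (et x) 1 : Matrix (Fin r ⊕ Fin q) (Fin r ⊕ Fin q) ℂ) * Ut x y.1 * bt x y.1) y.2.1 y.2.2 := by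
    intro x y
    have h1 : (fromBlocks 1 0 ep 1 : Matrix (Fin r ⊕ Fin q) (Fin r ⊕ Fin q) (MvPolynomial V ℂ)).map (eval x) = fromBlocks 1 0 (et x) 1 := by
      ext a b
      rcases a with a | i <;> rcases b with j | b <;>
        simp [ep, et, Matrix.one_apply, apply_ite (eval x)]
    have h2 : (Up y.1).map (eval x) = Ut x y.1 := by
      ext a b; simp only [Up, Ut, map_apply, of_apply]; split_ifs <;> simp
    have h3 : (bp y.1).map (eval x) = bt x y.1 := by
      ext a b; simp only [bp, bt, map_apply, of_apply]; split_ifs <;> simp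
    rw [← h1, ← h2, ← h3, ← Matrix.map_mul, ← Matrix.map_mul]
    rfl
  let U0 : Fin s → Matrix (Fin r ⊕ Fin q) (Fin r ⊕ Fin q) ℂ := fun l => fromBlocks (A l) 0 0 (B l)
  let x0 : V → ℂ := Sum.elim (fun _ => 0) (Sum.elim (fun y => U0 y.1 y.2.1 y.2.2)
    (fun y => (1 : Matrix (Fin r ⊕ Fin q) (Fin r ⊕ Fin q) ℂ) y.2.1 y.2.2))
  have hdense := dense_range_of_deriv f x0 (by
    intro z
    obtain ⟨η, hη⟩ := hT (fun l => B' l * Matrix.of (fun i j => z (l, Sum.inr i, Sum.inl j)))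
    let z21 : Fin s → Matrix (Fin q) (Fin r) ℂ := fun l => Matrix.of (fun i j => z (l, Sum.inr i, Sum.inl j))
    let b21 : Fin s → Matrix (Fin q) (Fin r) ℂ := fun l => B' l * z21 l - B' l * η * A l
    let be : Fin s → Matrix (Fin r ⊕ Fin q) (Fin r ⊕ Fin q) ℂ := fun l => fromBlocks 0 0 (b21 l) 0
    let hh : Matrix (Fin r ⊕ Fin q) (Fin r ⊕ Fin q) ℂ := fromBlocks 0 0 η 0
    let mu : Fin s → Matrix (Fin r ⊕ Fin q) (Fin r ⊕ Fin q) ℂ := fun l => Matrix.of (fun a b => z (l, a, b)) - hh * U0 l - U0 l * be l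
    have hb0 : ∀ l a b, ¬ (σ l a ≤ σ l b) → be l a b = 0 := by
      intro l a b hab
      rcases a with a | i <;> rcases b with j | b <;> simp only [be, fromBlocks_apply₁₁, fromBlocks_apply₁₂, fromBlocks_apply₂₁, fromBlocks_apply₂₂, Matrix.zero_apply]
      have : d l j ≤ (i : ℕ) := by
        by_contra hc
        exact hab (hσ l i j (by omega))
      simp only [b21, Matrix.sub_apply]
      rw [hη l i j this]; simp [z21]
    have hmu0 : ∀ l i j, mu l (Sum.inr i) (Sum.inl j) = 0 := by
      intro l i j
      have e1 : hh * U0 l + U0 l * be l = fromBlocks 0 0 (η * A l + B l * b21 l) 0 := by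
        simp [hh, U0, be, fromBlocks_multiply, fromBlocks_add]
      have e2 : η * A l + B l * b21 l = z21 l := by
        simp only [b21, Matrix.mul_sub]
        rw [← Matrix.mul_assoc, hB, Matrix.mul_assoc (B' l), ← Matrix.mul_assoc (B l), hB]
        simp
      have e3 : mu l = Matrix.of (fun a b => z (l, a, b)) - (hh * U0 l + U0 l * be l) := by
        simp only [mu]; abel
      rw [e3, e1, e2]; simp [z21]
    refine ⟨Sum.elim (fun y => η y.1 y.2) (Sum.elim (fun y => mu y.1 y.2.1 y.2.2)
      (fun y => be y.1 y.2.1 y.2.2)), ?_⟩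
    set v : V → ℂ := Sum.elim (fun y => η y.1 y.2) (Sum.elim (fun y => mu y.1 y.2.1 y.2.2)
      (fun y => be y.1 y.2.1 y.2.2)) with hv
    have k1 : ∀ t : ℂ, (fromBlocks 1 0 (et (x0 + t • v)) 1 : Matrix (Fin r ⊕ Fin q) (Fin r ⊕ Fin q) ℂ) = 1 + t • hh := by
      intro t
      rw [← fromBlocks_one]
      simp only [hh, fromBlocks_smul, fromBlocks_add]
      congr 1 <;> ext i j <;> simp [et, x0, v]
    have k2 : ∀ (t : ℂ) l, Ut (x0 + t • v) l = U0 l + t • mu l := by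
      intro t l
      ext a b
      rcases a with a | i <;> rcases b with j | b <;> simp [Ut, x0, v, U0, hmu0]
    have k3 : ∀ (t : ℂ) l, bt (x0 + t • v) l = 1 + t • be l := by
      intro t l
      ext a b
      simp only [bt, of_apply]
      split_ifs with h
      · simp [x0, v]
      · have : a ≠ b := by rintro rfl; exact h le_rfl
        simp [hb0 l a b h, this]
    rw [hasDerivAt_pi]
    rintro ⟨l, a, b⟩
    have key : ∀ t : ℂ, eval (x0 + t • v) (f (l, a, b)) = U0 l a b + t * z (l, a, b)
        + t ^ 2 * ((hh * mu l + hh * U0 l * be l + mu l * be l) a b)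
        + t ^ 3 * ((hh * mu l * be l) a b) := by
      intro t
      rw [hev]
      simp only [k1, k2, k3]
      have e : (1 + t • hh) * (U0 l + t • mu l) * (1 + t • be l) =
          U0 l + t • (Matrix.of (fun a b => z (l, a, b))) + t ^ 2 • (hh * mu l + hh * U0 l * be l + mu l * be l)
          + t ^ 3 • (hh * mu l * be l) := by
        have : (Matrix.of (fun a b => z (l, a, b))) = mu l + hh * U0 l + U0 l * be l := by
          simp only [mu]; abel
        rw [this]
        exact expand_triple t hh (U0 l) (mu l) (be l)
      rw [e]
      simp [Matrix.add_apply]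
      ring
    simp_rw [key]
    exact hasDerivAt_cubic _ _ _ _)
  refine hdense.mono ?_
  rintro _ ⟨x, rfl⟩
  refine ⟨et x, Ut x, bt x, ?_, ?_, ?_⟩
  · intro l i j; simp [Ut]
  · intro l c c' h; simp [bt, h]
  · intro l a b; exact hev x (l, a, b)

end Density


section Closed
open Matrix Topology

lemma isClosed_finrank_span_le {ι E : Type*} [Finite ι] [NormedAddCommGroup E] [NormedSpace ℂ E]
    [FiniteDimensional ℂ E] (k : ℕ) :
    IsClosed {f : ι → E | finrank ℂ (Submodule.span ℂ (Set.range f)) ≤ k} := by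
  have : {f : ι → E | finrank ℂ (Submodule.span ℂ (Set.range f)) ≤ k}ᶜ =
      ⋃ e : Fin (k + 1) → ι, {f : ι → E | LinearIndependent ℂ (f ∘ e)} := by
    ext f
    simp only [Set.mem_compl_iff, Set.mem_setOf_eq, not_le, Set.mem_iUnion]
    constructor
    · intro h
      obtain ⟨v, hv, -, hli⟩ := Submodule.exists_fun_fin_finrank_span_eq ℂ (Set.range f)
      choose e he using hv
      refine ⟨fun i => e (Fin.castLE h i), ?_⟩
      have := hli.comp (Fin.castLE h) (Fin.castLE_injective h)
      have h2 : f ∘ (fun i => e (Fin.castLE h i)) = v ∘ Fin.castLE h := by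
        ext i; simp [he]
      rw [h2]; exact this
    · rintro ⟨e, he⟩
      have h1 := finrank_span_eq_card he
      have h2 : Submodule.span ℂ (Set.range (f ∘ e)) ≤ Submodule.span ℂ (Set.range f) :=
        Submodule.span_mono (Set.range_comp_subset_range e f)
      have h3 := Submodule.finrank_mono h2
      simp at h1
      omega
  rw [← isOpen_compl_iff, this]
  refine isOpen_iUnion (fun e => ?_)
  have hc : Continuous (fun f : ι → E => f ∘ e) := by fun_prop
  exact isOpen_setOfPred_linearIndependent.preimage hc

/-- Family spanning `V + E_l(k)`. -/
noncomputable def famXg {s r n : ℕ} {K : Type} (σ : Fin s → K ≃ Fin n)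
    (X : Fin r → EuclideanSpace ℂ K) (g : Fin s × K × K → ℂ) (l : Fin s) (k : Fin n) :
    Fin r ⊕ K → EuclideanSpace ℂ K :=
  Sum.elim X (fun c => if σ l c ≤ k then WithLp.toLp 2 (fun a => g (l, a, c)) else 0)

lemma isClosed_Z {s r n : ℕ} {K : Type} [Fintype K] (σ : Fin s → K ≃ Fin n)
    (I : Fin s → Fin r → Fin n) (d : Fin s → Fin r → ℕ) :
    IsClosed {g : Fin s × K × K → ℂ | ∃ X : Fin r → EuclideanSpace ℂ K, Orthonormal ℂ X ∧
      ∀ l j, finrank ℂ (Submodule.span ℂ (Set.range (famXg σ X g l (I l j)))) ≤ r + d l j} := by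
  classical
  let C : Set (Fin r → EuclideanSpace ℂ K) := {X | Orthonormal ℂ X}
  have hCcl : IsClosed C := by
    have : C = ⋂ i, ⋂ j, {X : Fin r → EuclideanSpace ℂ K | inner ℂ (X i) (X j) = if i = j then (1:ℂ) else 0} := by
      ext X
      simp only [C, Set.mem_setOf_eq, Set.mem_iInter]
      exact orthonormal_iff_ite
    rw [this]
    refine isClosed_iInter fun i => isClosed_iInter fun j => isClosed_eq ?_ continuous_const
    fun_prop
  have hCb : Bornology.IsBounded C := by
    refine (Metric.isBounded_closedBall (x := (0 : Fin r → EuclideanSpace ℂ K)) (r := 1)).subset ?_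
    intro X hX
    rw [mem_closedBall_zero_iff, pi_norm_le_iff_of_nonneg zero_le_one]
    intro i
    exact (hX.1 i).le
  have hC : IsCompact C := Metric.isCompact_of_isClosed_isBounded hCcl hCb
  have : CompactSpace C := isCompact_iff_compactSpace.1 hC
  let S : Set (C × (Fin s × K × K → ℂ)) := {p | ∀ l j,
    finrank ℂ (Submodule.span ℂ (Set.range (famXg σ p.1.1 p.2 l (I l j)))) ≤ r + d l j}
  have hS : IsClosed S := by
    have : S = ⋂ l, ⋂ j, (fun p : C × (Fin s × K × K → ℂ) => famXg σ p.1.1 p.2 l (I l j)) ⁻¹'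
        {f | finrank ℂ (Submodule.span ℂ (Set.range f)) ≤ r + d l j} := by
      ext p; simp [S]
    rw [this]
    refine isClosed_iInter fun l => isClosed_iInter fun j =>
      (isClosed_finrank_span_le _).preimage ?_
    refine continuous_pi (fun c => ?_)
    rcases c with i | c
    · simp only [famXg, Sum.elim_inl]
      exact (continuous_apply i).comp (continuous_subtype_val.comp continuous_fst)
    · simp only [famXg, Sum.elim_inr]
      split_ifs
      · apply (PiLp.continuous_toLp 2 _).comp
        fun_prop
      · exact continuous_const
  have := isClosedMap_snd_of_compactSpace S hS
  convert this using 1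
  ext g
  constructor
  · rintro ⟨X, hX, h⟩
    exact ⟨(⟨X, hX⟩, g), h, rfl⟩
  · rintro ⟨⟨X, g'⟩, h, rfl⟩
    exact ⟨X.1, X.2, h⟩

lemma mem_Z {s r q n : ℕ} (σ : Fin s → (Fin r ⊕ Fin q) ≃ Fin n)
    (I : Fin s → Fin r → Fin n) (d : Fin s → Fin r → ℕ)
    (hd : ∀ l (i : Fin q) j, σ l (Sum.inr i) ≤ I l j → (i : ℕ) < d l j)
    (g : Fin s × (Fin r ⊕ Fin q) × (Fin r ⊕ Fin q) → ℂ)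
    (η : Matrix (Fin q) (Fin r) ℂ) (U β : Fin s → Matrix (Fin r ⊕ Fin q) (Fin r ⊕ Fin q) ℂ)
    (hU : ∀ l i j, U l (Sum.inr i) (Sum.inl j) = 0)
    (hβ : ∀ l c c', ¬ (σ l c ≤ σ l c') → β l c c' = 0)
    (hg : ∀ l a b, g (l, a, b) =
      ((fromBlocks 1 0 η 1 : Matrix (Fin r ⊕ Fin q) (Fin r ⊕ Fin q) ℂ) * U l * β l) a b) :
    ∃ X : Fin r → EuclideanSpace ℂ (Fin r ⊕ Fin q), Orthonormal ℂ X ∧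
      ∀ l j, finrank ℂ (Submodule.span ℂ (Set.range (famXg σ X g l (I l j)))) ≤ r + d l j := by
  classical
  set H : Matrix (Fin r ⊕ Fin q) (Fin r ⊕ Fin q) ℂ := fromBlocks 1 0 η 1 with hH
  let x : Fin r → EuclideanSpace ℂ (Fin r ⊕ Fin q) := fun i => WithLp.toLp 2 (fun a => H a (Sum.inl i))
  have hx : LinearIndependent ℂ x := by
    rw [Fintype.linearIndependent_iff]
    intro c hc i
    have := congrArg (fun w : EuclideanSpace ℂ (Fin r ⊕ Fin q) => w (Sum.inl i)) hc
    simpa [x, hH, Matrix.one_apply] using this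
  set V := Submodule.span ℂ (Set.range x) with hV
  have hVr : finrank ℂ V = r := by
    rw [hV, finrank_span_eq_card hx]; simp
  let b := (stdOrthonormalBasis ℂ V).reindex (finCongr hVr)
  refine ⟨fun i => (b i : EuclideanSpace ℂ (Fin r ⊕ Fin q)), ?_, ?_⟩
  · exact b.orthonormal.comp_linearIsometry V.subtypeₗᵢ
  intro l j
  -- columns of H * U
  let w : (Fin r ⊕ Fin q) → EuclideanSpace ℂ (Fin r ⊕ Fin q) := fun c => WithLp.toLp 2 (fun a => (H * U l) a c)
  let W := Submodule.span ℂ (Set.range (fun i : {i : Fin q // (i : ℕ) < d l j} => w (Sum.inr i.1)))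
  have hwl : ∀ i, w (Sum.inl i) ∈ V := by
    intro i
    have : w (Sum.inl i) = ∑ k, U l (Sum.inl k) (Sum.inl i) • x k := by
      ext a
      simp [w, x, Matrix.mul_apply, hU, mul_comm]
    rw [this]
    exact Submodule.sum_mem _ fun k _ => Submodule.smul_mem _ _ (Submodule.subset_span ⟨k, rfl⟩)
  have hw : ∀ c, σ l c ≤ I l j → w c ∈ V ⊔ W := by
    rintro (i | i) hc
    · exact (le_sup_left : V ≤ V ⊔ W) (hwl i)
    · exact (le_sup_right : W ≤ V ⊔ W) (Submodule.subset_span ⟨⟨i, hd l i j hc⟩, rfl⟩)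
  have hle : Submodule.span ℂ (Set.range (famXg σ (fun i => (b i : EuclideanSpace ℂ (Fin r ⊕ Fin q))) g l (I l j))) ≤ V ⊔ W := by
    rw [Submodule.span_le]
    rintro _ ⟨c, rfl⟩
    rcases c with i | c
    · exact (le_sup_left : V ≤ V ⊔ W) (b i).2
    · simp only [famXg, Sum.elim_inr]
      split_ifs with hc
      · have : (WithLp.toLp 2 (fun a => g (l, a, c)) : EuclideanSpace ℂ (Fin r ⊕ Fin q)) =
            ∑ k, β l k c • w k := by
          ext a
          simp only [hg, w]
          rw [Matrix.mul_apply]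
          simp [mul_comm]
        rw [this]
        refine Submodule.sum_mem _ fun k _ => ?_
        by_cases hk : σ l k ≤ σ l c
        · exact Submodule.smul_mem _ _ (hw k (hk.trans hc))
        · simp [hβ l k c hk]
      · exact Submodule.zero_mem _
  calc _ ≤ finrank ℂ ↥(V ⊔ W) := Submodule.finrank_mono hle
    _ ≤ finrank ℂ V + finrank ℂ W := Submodule.finrank_add_le_finrank_add_finrank V W
    _ ≤ r + d l j := by
      rw [hVr]
      refine Nat.add_le_add_left ?_ _
      refine (finrank_range_le_card _).trans ?_
      rw [Fintype.card_subtype]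
      calc _ ≤ (Finset.range (d l j)).card := by
            refine Finset.card_le_card_of_injOn (fun i => (i : ℕ)) ?_ (Fin.val_injective.injOn)
            intro i hi; simpa using hi
        _ = _ := Finset.card_range _

end Closed


section FlagBasis
open Matrix

lemma flagAt_finrank {m : ℕ} (F : Flagg m) (k : ℕ) (hk : k ≤ m) : finrank ℂ (flagAt F k) = k := by
  cases k with
  | zero =>
    have h : flagAt F 0 = ⊥ := rfl
    rw [h, finrank_bot]
  | succ k =>
    have h : flagAt F (k + 1) = F.F ⟨k, hk⟩ := by simp only [flagAt]; rw [dif_pos (by omega)]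
    rw [h, F.rank_eq]

lemma flagAt_le_succ {m : ℕ} (F : Flagg m) (k : ℕ) : flagAt F k ≤ flagAt F (k + 1) := by
  cases k with
  | zero => simp [flagAt]
  | succ k =>
    simp only [flagAt]
    split_ifs with h1 h2
    · exact F.mono (by simp)
    · exact le_top
    · omega
    · exact le_top

lemma flagAt_mono {m : ℕ} (F : Flagg m) : Monotone (flagAt F) :=
  monotone_nat_of_le_succ (flagAt_le_succ F)

lemma flag_eq_flagAt {m : ℕ} (F : Flagg m) (i : Fin m) : F.F i = flagAt F (i + 1) := by
  simp [flagAt]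

lemma exists_flag_basis {m : ℕ} (F : Flagg m) : ∃ v : Fin m → (Fin m → ℂ),
    LinearIndependent ℂ v ∧
    ∀ k ≤ m, flagAt F k = Submodule.span ℂ (v '' {i | (i : ℕ) < k}) := by
  have hex : ∀ i : Fin m, ∃ x, x ∈ flagAt F (i + 1) ∧ x ∉ flagAt F i := by
    intro i
    by_contra! h
    have h1 : flagAt F (i + 1) ≤ flagAt F i := fun x hx => h x hx
    have h2 := Submodule.finrank_mono h1
    rw [flagAt_finrank _ _ i.2.le, flagAt_finrank _ _ i.2] at h2
    omega
  choose v hv hv' using hex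
  have key : ∀ k ≤ m, flagAt F k = Submodule.span ℂ (v '' {i | (i : ℕ) < k}) := by
    intro k
    induction k with
    | zero => intro _; simp [flagAt]
    | succ k ih =>
      intro hk
      have ih := ih (by omega)
      have hle : Submodule.span ℂ (v '' {i | (i : ℕ) < k + 1}) ≤ flagAt F (k + 1) := by
        rw [Submodule.span_le]
        rintro _ ⟨i, hi, rfl⟩
        exact flagAt_mono F (by simpa using hi) (hv i)
      have hlt : flagAt F k < Submodule.span ℂ (v '' {i | (i : ℕ) < k + 1}) := by
        refine lt_of_le_of_ne ?_ ?_
        · rw [ih]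
          exact Submodule.span_mono (Set.image_mono fun i (hi : (i : ℕ) < k) => Nat.lt_succ_of_lt hi)
        · intro he
          apply hv' ⟨k, hk⟩
          show v ⟨k, hk⟩ ∈ flagAt F k
          rw [he]
          exact Submodule.subset_span ⟨⟨k, hk⟩, by simp, rfl⟩
      have h3 := Submodule.finrank_lt_finrank_of_lt hlt
      rw [flagAt_finrank _ _ (by omega)] at h3
      symm
      apply Submodule.eq_of_le_of_finrank_le hle
      rw [flagAt_finrank _ _ hk]
      exact h3
  refine ⟨v, ?_, key⟩
  apply linearIndependent_of_top_le_span_of_card_eq_finrank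
  · have h1 := key m le_rfl
    have h2 : {i : Fin m | (i : ℕ) < m} = Set.univ := by ext i; simp
    rw [h2, Set.image_univ] at h1
    rw [← h1]
    apply le_of_eq
    symm
    apply Submodule.eq_top_of_finrank_eq
    rw [flagAt_finrank _ _ le_rfl]; simp
  · simp

/-- flag from a basis -/
def flagOf {m : ℕ} (v : Fin m → (Fin m → ℂ)) (hv : LinearIndependent ℂ v) : Flagg m where
  F i := Submodule.span ℂ (v '' {i' | (i' : ℕ) < (i : ℕ) + 1})
  mono := by
    intro i j hij
    refine Submodule.span_mono (Set.image_mono fun k hk => ?_)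
    have : (i : ℕ) ≤ j := hij
    simp only [Set.mem_setOf_eq] at *
    omega
  rank_eq := by
    intro i
    have h1 := finrank_span_eq_card
      (hv.comp (fun x : {i' : Fin m // (i' : ℕ) < (i : ℕ) + 1} => x.1) Subtype.val_injective)
    have h2 : Set.range (v ∘ (fun x : {i' : Fin m // (i' : ℕ) < (i : ℕ) + 1} => x.1)) =
      v '' {i' | (i' : ℕ) < (i : ℕ) + 1} := by
      ext x; simp
    rw [h2] at h1
    rw [h1]
    rw [Fintype.card_subtype]
    have h3 : (Finset.univ.filter (fun i' : Fin m => (i' : ℕ) < (i : ℕ) + 1)) = Finset.Iic i := by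
      ext x
      simp only [Finset.mem_filter, Finset.mem_univ, true_and, Finset.mem_Iic, Fin.le_def]
      omega
    rw [h3, Fin.card_Iic]

lemma flagAt_flagOf {m : ℕ} (v : Fin m → (Fin m → ℂ)) (hv : LinearIndependent ℂ v) (k : ℕ)
    (hk : k ≤ m) : flagAt (flagOf v hv) k = Submodule.span ℂ (v '' {i | (i : ℕ) < k}) := by
  cases k with
  | zero => simp [flagAt]
  | succ k => simp only [flagAt]; rw [dif_pos (by omega)]; rfl

lemma flagg_nonempty (m : ℕ) : Nonempty (Flagg m) :=
  ⟨flagOf (fun i => Pi.single i 1) (Pi.linearIndependent_single_one (Fin m) ℂ)⟩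

/-- coordinates -/
lemma mem_span_cols {m : ℕ} (b b' : Matrix (Fin m) (Fin m) ℂ) (h : b' * b = 1) (k : ℕ)
    (x : Fin m → ℂ) :
    x ∈ Submodule.span ℂ ((fun i a => b a i) '' {i : Fin m | (i : ℕ) < k}) ↔
      ∀ i : Fin m, k ≤ i → (b' *ᵥ x) i = 0 := by
  constructor
  · intro hx i hi
    induction hx using Submodule.span_induction with
    | mem x hx =>
      obtain ⟨c, hc, rfl⟩ := hx
      have : (b' *ᵥ fun a => b a c) i = (b' * b) i c := by
        simp [Matrix.mulVec, Matrix.mul_apply, dotProduct]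
      rw [this, h, Matrix.one_apply_ne]
      rintro rfl
      simp at hc; omega
    | zero => simp
    | add x y _ _ hx hy => rw [Matrix.mulVec_add, Pi.add_apply, hx, hy, add_zero]
    | smul a x _ hx => rw [Matrix.mulVec_smul, Pi.smul_apply, hx, smul_zero]
  · intro hx
    have h' : b * b' = 1 := mul_eq_one_comm.mp h
    have hxx : x = ∑ i, (b' *ᵥ x) i • (fun a => b a i) := by
      have h1 : x = b *ᵥ (b' *ᵥ x) := by rw [Matrix.mulVec_mulVec, h', Matrix.one_mulVec]
      nth_rewrite 1 [h1]
      ext a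
      simp [Matrix.mulVec, dotProduct, mul_comm]
    rw [hxx]
    refine Submodule.sum_mem _ fun i _ => ?_
    by_cases hi : (i : ℕ) < k
    · exact Submodule.smul_mem _ _ (Submodule.subset_span ⟨i, hi, rfl⟩)
    · rw [hx i (by omega), zero_smul]; exact Submodule.zero_mem _

lemma flag_matrix {m : ℕ} (F : Flagg m) : ∃ b b' : Matrix (Fin m) (Fin m) ℂ, b' * b = 1 ∧
    ∀ k ≤ m, flagAt F k = Submodule.span ℂ ((fun i a => b a i) '' {i : Fin m | (i : ℕ) < k}) := by
  obtain ⟨v, hv, h⟩ := exists_flag_basis F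
  let b : Matrix (Fin m) (Fin m) ℂ := (Matrix.of v)ᵀ
  have hu : IsUnit b := by
    rw [← Matrix.linearIndependent_cols_iff_isUnit]; exact hv
  refine ⟨b, b⁻¹, Matrix.nonsing_inv_mul _ ((Matrix.isUnit_iff_isUnit_det _).1 hu), h⟩

lemma flag_of_matrix {m : ℕ} (b b' : Matrix (Fin m) (Fin m) ℂ) (hb : b' * b = 1) :
    ∃ F : Flagg m, 
    ∀ k ≤ m, flagAt F k = Submodule.span ℂ ((fun i a => b a i) '' {i : Fin m | (i : ℕ) < k}) := by
  have hu : IsUnit b := ⟨⟨b, b', mul_eq_one_comm.mp hb, hb⟩, rfl⟩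
  have hv : LinearIndependent ℂ (fun i a => b a i) := Matrix.linearIndependent_cols_iff_isUnit.2 hu
  exact ⟨flagOf _ hv, flagAt_flagOf _ hv⟩

end FlagBasis

section Shuffle

lemma exists_shuffle {r n : ℕ} (hrn : r ≤ n) (I : Fin r → Fin n) (hI : StrictMono I) :
    ∃ σ : (Fin r ⊕ Fin (n - r)) ≃ Fin n, (∀ j, σ (Sum.inl j) = I j) ∧
      ∀ (i : Fin (n - r)) j, σ (Sum.inr i) ≤ I j ↔ (i : ℕ) < (I j : ℕ) - j := by
  classical
  let S : Finset (Fin n) := Finset.univ.image I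
  have hS : S.card = r := by
    rw [Finset.card_image_of_injective _ hI.injective]; simp
  have hS' : Sᶜ.card = n - r := by rw [Finset.card_compl, hS]; simp
  let σ := finSumEquivOfFinset hS hS'
  have h1 : ∀ j, σ (Sum.inl j) = I j := by
    intro j
    rw [finSumEquivOfFinset_inl]
    have := Finset.orderEmbOfFin_unique hS (f := I) (fun x => by simp [S]) hI
    exact (congrFun this j).symm
  have hmono : StrictMono (fun i => σ (Sum.inr i)) := by
    intro a b hab
    simp only [σ, finSumEquivOfFinset_inr]
    exact (Sᶜ.orderEmbOfFin hS').strictMono hab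
  refine ⟨σ, h1, fun i j => ?_⟩
  -- count
  have hcard : (Finset.univ.filter (fun c => σ c ≤ I j)).card = (I j : ℕ) + 1 := by
    have : (Finset.univ.filter (fun c => σ c ≤ I j)).map σ.toEmbedding = Finset.Iic (I j) := by
      ext x; simp
    rw [← Finset.card_map σ.toEmbedding, this, Fin.card_Iic]
  have hsplit : (Finset.univ.filter (fun c => σ c ≤ I j)).card =
      (Finset.univ.filter (fun i : Fin r => σ (Sum.inl i) ≤ I j)).card +
      (Finset.univ.filter (fun i : Fin (n - r) => σ (Sum.inr i) ≤ I j)).card := by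
    rw [Finset.card_filter, Finset.card_filter, Finset.card_filter, Fintype.sum_sum_type]
  have hl : (Finset.univ.filter (fun i : Fin r => σ (Sum.inl i) ≤ I j)).card = j + 1 := by
    have : (Finset.univ.filter (fun i : Fin r => σ (Sum.inl i) ≤ I j)) = Finset.Iic j := by
      ext x; simp [h1, hI.le_iff_le]
    rw [this, Fin.card_Iic]
  have hc : (Finset.univ.filter (fun i : Fin (n - r) => σ (Sum.inr i) ≤ I j)).card =
    (I j : ℕ) - j := by omega
  constructor
  · intro h
    have : Finset.Iic i ⊆ (Finset.univ.filter (fun i : Fin (n - r) => σ (Sum.inr i) ≤ I j)) := by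
      intro x hx
      simp only [Finset.mem_Iic] at hx
      simp only [Finset.mem_filter, Finset.mem_univ, true_and]
      exact (hmono.monotone hx).trans h
    have := Finset.card_le_card this
    rw [hc, Fin.card_Iic] at this
    omega
  · intro h
    by_contra h'
    have : (Finset.univ.filter (fun i : Fin (n - r) => σ (Sum.inr i) ≤ I j)) ⊆ Finset.Iio i := by
      intro x hx
      simp only [Finset.mem_filter, Finset.mem_univ, true_and] at hx
      simp only [Finset.mem_Iio]
      by_contra hxi
      exact h' ((hmono.monotone (not_lt.1 hxi)).trans hx)
    have := Finset.card_le_card this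
    rw [hc, Fin.card_Iio] at this
    omega

end Shuffle


section Geometric
open Matrix

lemma subset_bounds {r n : ℕ} {I : Fin r → Fin n} (hI : StrictMono I) (j : Fin r) :
    (j : ℕ) ≤ I j ∧ (I j : ℕ) - j ≤ n - r := by
  have key : ∀ (k a : ℕ) (h : a + k < r), (I ⟨a, by omega⟩ : ℕ) + k ≤ I ⟨a + k, h⟩ := by
    intro k
    induction k with
    | zero => intro a h; simp
    | succ k ih =>
      intro a h
      have h1 := ih a (by omega)
      have h2 : I ⟨a + k, by omega⟩ < I ⟨a + (k + 1), h⟩ := hI (by simp [Fin.lt_def])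
      rw [Fin.lt_def] at h2
      omega
  have hj := j.2
  constructor
  · have h1 := key j 0 (by omega)
    simp only [Nat.zero_add] at h1
    exact le_trans (Nat.le_add_left _ _) h1
  · have h1 := key (r - 1 - j) j (by omega)
    have h2 := (I ⟨(j : ℕ) + (r - 1 - j), by omega⟩).2
    have h3 : (⟨(j : ℕ), by omega⟩ : Fin r) = j := rfl
    rw [h3] at h1
    omega

lemma intersecting_of_surj {s r n : ℕ} (hrn : r ≤ n)
    (I : Fin s → Fin r → Fin n) (hI : ∀ l, StrictMono (I l))
    (A : Fin s → Matrix (Fin r) (Fin r) ℂ) (B B' : Fin s → Matrix (Fin (n - r)) (Fin (n - r)) ℂ)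
    (hB : ∀ l, B l * B' l = 1)
    (hT : ∀ w : Fin s → Matrix (Fin (n - r)) (Fin r) ℂ, ∃ η : Matrix (Fin (n - r)) (Fin r) ℂ, ∀ l (i : Fin (n - r)) j,
      (I l j : ℕ) - (j : ℕ) ≤ i → (B' l * η * A l) i j = w l i j) :
    Intersecting I := by
  classical
  choose σ hσ1 hσ2 using fun l => exists_shuffle hrn (I l) (hI l)
  let d : Fin s → Fin r → ℕ := fun l j => (I l j : ℕ) - (j : ℕ)
  have hdense := dense_param d σ (fun l i j h => by rw [hσ1]; exact (hσ2 l i j).2 h) A B B' hB hT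
  have hclosed := isClosed_Z σ I d
  have hZ := fun g => (hclosed.closure_subset_iff.2 (fun g hg => by
    obtain ⟨η, U, β, hU, hβ, hg⟩ := hg
    exact mem_Z σ I d (fun l i j h => (hσ2 l i j).1 h) g η U β hU hβ hg)) (hdense g)
  intro F
  choose v hv hF using fun l => exists_flag_basis (F l)
  let e : (Fin r ⊕ Fin (n - r)) ≃ Fin n := finSumFinEquiv.trans (finCongr (by omega))
  obtain ⟨X, hX, hXd⟩ := hZ (fun p => v p.1 (σ p.1 p.2.2) (e p.2.1))
  let L : EuclideanSpace ℂ (Fin r ⊕ Fin (n - r)) ≃ₗ[ℂ] (Fin n → ℂ) :=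
    (WithLp.linearEquiv 2 ℂ (Fin r ⊕ Fin (n - r) → ℂ)).trans (LinearEquiv.funCongrLeft ℂ ℂ e.symm)
  let V0 := Submodule.span ℂ (Set.range X)
  have hV0 : finrank ℂ V0 = r := by
    rw [finrank_span_eq_card hX.linearIndependent]; simp
  have hV : finrank ℂ (V0.map L.toLinearMap) = r := by
    rw [LinearEquiv.finrank_map_eq]; exact hV0
  refine ⟨V0.map L.toLinearMap, hV, fun l j => ?_⟩
  set W := Submodule.span ℂ (Set.range (famXg σ X (fun p => v p.1 (σ p.1 p.2.2) (e p.2.1)) l (I l j)))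
    with hW
  have hle : V0.map L.toLinearMap ⊔ (F l).F (I l j) ≤ W.map L.toLinearMap := by
    refine sup_le (Submodule.map_mono (Submodule.span_mono ?_)) ?_
    · rintro _ ⟨i, rfl⟩
      exact ⟨Sum.inl i, rfl⟩
    · rw [flag_eq_flagAt, hF l _ (I l j).2, Submodule.span_le]
      rintro _ ⟨i, hi, rfl⟩
      refine ⟨famXg σ X (fun p => v p.1 (σ p.1 p.2.2) (e p.2.1)) l (I l j) (Sum.inr ((σ l).symm i)),
        Submodule.subset_span ⟨_, rfl⟩, ?_⟩
      have hi' : i ≤ I l j := by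
        simp only [Set.mem_setOf_eq] at hi
        rw [Fin.le_def]; omega
      ext a
      simp [famXg, hi', L, LinearEquiv.funCongrLeft]
  have h1 := Submodule.finrank_mono hle
  rw [LinearEquiv.finrank_map_eq] at h1
  have h2 := Submodule.finrank_sup_add_finrank_inf_eq (V0.map L.toLinearMap) ((F l).F (I l j))
  rw [hV, (F l).rank_eq] at h2
  have h3 := h1.trans (hXd l j)
  have h4 : (j : ℕ) ≤ I l j := (subset_bounds (hI l) j).1
  simp only [d] at h3
  omega

end Geometric


section Algebraic
open Matrix Topology

/-- The masked linear map whose kernel is `ℒ_I(F,G)`. -/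
noncomputable def maskT {s r q : ℕ} (d : Fin s → Fin r → ℕ) (a : Fin s → Matrix (Fin r) (Fin r) ℂ)
    (b' : Fin s → Matrix (Fin q) (Fin q) ℂ) :
    Matrix (Fin q) (Fin r) ℂ →ₗ[ℂ]
      ({p : Fin s × Fin q × Fin r // d p.1 p.2.2 ≤ (p.2.1 : ℕ)} → ℂ) where
  toFun η p := (b' p.1.1 * η * a p.1.1) p.1.2.1 p.1.2.2
  map_add' x y := by ext p; simp [Matrix.mul_add, Matrix.add_mul]
  map_smul' c x := by ext p; simp

lemma subset_mono {r n : ℕ} {I : Fin r → Fin n} (hI : StrictMono I) {j j' : Fin r} (h : j ≤ j') :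
    (I j : ℕ) - j ≤ (I j' : ℕ) - j' := by
  have key : ∀ (k a : ℕ) (h : a + k < r), (I ⟨a, by omega⟩ : ℕ) + k ≤ I ⟨a + k, h⟩ := by
    intro k
    induction k with
    | zero => intro a h; simp
    | succ k ih =>
      intro a h
      have h1 := ih a (by omega)
      have h2 : I ⟨a + k, by omega⟩ < I ⟨a + (k + 1), h⟩ := hI (by simp [Fin.lt_def])
      rw [Fin.lt_def] at h2
      omega
  obtain ⟨j, hj⟩ := j
  obtain ⟨j', hj'⟩ := j'
  obtain ⟨k, rfl⟩ := Nat.exists_eq_add_of_le (show j ≤ j' from h)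
  have := key k j hj'
  simp only
  omega

lemma mem_LSpace_iff {s r q : ℕ} (I : Fin s → Fin r → ℕ) (d : Fin s → Fin r → ℕ)
    (hd : ∀ l j, d l j = I l j - (j : ℕ)) (hdq : ∀ l j, d l j ≤ q)
    (hdm : ∀ l, Monotone (d l))
    (F : Fin s → Flagg r) (G : Fin s → Flagg q)
    (a : Fin s → Matrix (Fin r) (Fin r) ℂ) (b b' : Fin s → Matrix (Fin q) (Fin q) ℂ)
    (ha : ∀ l, ∀ k ≤ r, flagAt (F l) k =
      Submodule.span ℂ ((fun i c => a l c i) '' {i : Fin r | (i : ℕ) < k}))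
    (hbb : ∀ l, b' l * b l = 1)
    (hb : ∀ l, ∀ k ≤ q, flagAt (G l) k =
      Submodule.span ℂ ((fun i c => b l c i) '' {i : Fin q | (i : ℕ) < k}))
    (φ : (Fin r → ℂ) →ₗ[ℂ] (Fin q → ℂ)) :
    φ ∈ LSpace I F G ↔ maskT d a b' (LinearMap.toMatrix' φ) = 0 := by
  have hent : ∀ l i j, (b' l * LinearMap.toMatrix' φ * a l) i j =
      (b' l *ᵥ φ (fun c => a l c j)) i := by
    intro l i j
    rw [← LinearMap.toMatrix'_mulVec φ, Matrix.mulVec_mulVec]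
    rfl
  have hG : ∀ l j x, x ∈ flagAt (G l) (I l j - (j : ℕ)) ↔
      ∀ i : Fin q, d l j ≤ i → (b' l *ᵥ x) i = 0 := by
    intro l j x
    rw [← hd, hb l _ (hdq l j), mem_span_cols (b l) (b' l) (hbb l)]
  constructor
  · intro h
    ext ⟨⟨l, i, j⟩, hp⟩
    show (b' l * LinearMap.toMatrix' φ * a l) i j = 0
    rw [hent]
    refine (hG l j _).1 (h l j _ ?_) i hp
    rw [flag_eq_flagAt, ha l _ j.2]
    exact Submodule.subset_span ⟨j, by simp, rfl⟩
  · intro h l j v hv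
    rw [flag_eq_flagAt, ha l _ j.2] at hv
    induction hv using Submodule.span_induction with
    | mem x hx =>
      obtain ⟨j', hj', rfl⟩ := hx
      rw [hG]
      intro i hi
      rw [← hent]
      have hjj : j' ≤ j := by
        simp only [Set.mem_setOf_eq] at hj'
        rw [Fin.le_def]; omega
      exact congrFun h ⟨(l, i, j'), (hdm l hjj).trans hi⟩
    | zero => simp
    | add x y _ _ hx hy => rw [map_add]; exact Submodule.add_mem _ hx hy
    | smul c x _ hx => rw [map_smul]; exact Submodule.smul_mem _ _ hx

lemma finrank_LSpace {s r q : ℕ} (I : Fin s → Fin r → ℕ) (d : Fin s → Fin r → ℕ)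
    (F : Fin s → Flagg r) (G : Fin s → Flagg q)
    (a : Fin s → Matrix (Fin r) (Fin r) ℂ) (b' : Fin s → Matrix (Fin q) (Fin q) ℂ)
    (h : ∀ φ, φ ∈ LSpace I F G ↔ maskT d a b' (LinearMap.toMatrix' φ) = 0) :
    finrank ℂ (LSpace I F G) = finrank ℂ (LinearMap.ker (maskT d a b')) := by
  have : (LSpace I F G).map (LinearMap.toMatrix' : _ ≃ₗ[ℂ] Matrix (Fin q) (Fin r) ℂ).toLinearMap =
      LinearMap.ker (maskT d a b') := by
    ext η
    constructor
    · rintro ⟨φ, hφ, rfl⟩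
      exact (h φ).1 hφ
    · intro hη
      refine ⟨Matrix.toLin' η, (h _).2 ?_, ?_⟩
      · rw [LinearMap.toMatrix'_toLin']; exact hη
      · exact LinearMap.toMatrix'_toLin' η
  rw [← this, LinearEquiv.finrank_map_eq]

lemma perturb_ker {E H : Type*} [AddCommGroup E] [Module ℂ E] [FiniteDimensional ℂ E]
    [NormedAddCommGroup H] [NormedSpace ℂ H] [FiniteDimensional ℂ H]
    (T0 T1 : E →ₗ[ℂ] H) (x : E) (hx : T0 x = 0) (hx1 : T1 x ∉ LinearMap.range T0) :
    ∀ᶠ t : ℂ in 𝓝[≠] 0, finrank ℂ (LinearMap.ker (T0 + t • T1)) < finrank ℂ (LinearMap.ker T0) := by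
  let k := finrank ℂ (LinearMap.range T0)
  let bb := finBasis ℂ (LinearMap.range T0)
  choose u hu using fun i => (bb i).2
  let fam : ℂ → Fin (k + 1) → H := fun t => Fin.cons (T1 x) (fun i => (T0 + t • T1) (u i))
  have h0 : LinearIndependent ℂ (fam 0) := by
    rw [linearIndependent_finCons]
    have h1 : (fun i => (T0 + (0 : ℂ) • T1) (u i)) = fun i => ((bb i : LinearMap.range T0) : H) := by
      ext i; simp [hu]
    rw [h1]
    refine ⟨bb.linearIndependent.map' (Submodule.subtype _) (Submodule.ker_subtype _), ?_⟩
    intro h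
    apply hx1
    refine Submodule.span_le.2 ?_ h
    rintro _ ⟨i, rfl⟩
    exact (bb i).2
  have hc : Continuous fam := by
    refine continuous_pi fun i => ?_
    refine Fin.cases ?_ (fun i => ?_) i
    · simp only [fam, Fin.cons_zero]; exact continuous_const
    · simp only [fam, Fin.cons_succ, LinearMap.add_apply, LinearMap.smul_apply]
      fun_prop
  have hev : ∀ᶠ t in 𝓝 (0 : ℂ), LinearIndependent ℂ (fam t) :=
    (isOpen_setOfPred_linearIndependent.preimage hc).mem_nhds h0
  filter_upwards [hev.filter_mono nhdsWithin_le_nhds, self_mem_nhdsWithin] with t ht ht0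
  have ht0 : t ≠ 0 := ht0
  have h1 := finrank_span_eq_card ht
  have h2 : Submodule.span ℂ (Set.range (fam t)) ≤ LinearMap.range (T0 + t • T1) := by
    rw [Submodule.span_le]
    rintro _ ⟨i, rfl⟩
    refine Fin.cases ?_ (fun i => ?_) i
    · refine ⟨t⁻¹ • x, ?_⟩
      simp [fam, hx, ht0]
    · exact ⟨u i, by simp [fam]⟩
  have h3 := Submodule.finrank_mono h2
  have h4 := LinearMap.finrank_range_add_finrank_ker T0
  have h5 := LinearMap.finrank_range_add_finrank_ker (T0 + t • T1)
  rw [h1, Fintype.card_fin] at h3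
  have h6 : k = finrank ℂ (LinearMap.range T0) := rfl
  omega

lemma card_mask {s r n : ℕ} (hrn : r ≤ n) (I : Fin s → Fin r → Fin n) (hI : ∀ l, StrictMono (I l))
    (hedim : 0 ≤ edim I) :
    Fintype.card {p : Fin s × Fin (n - r) × Fin r //
      (I p.1 p.2.2 : ℕ) - (p.2.2 : ℕ) ≤ (p.2.1 : ℕ)} ≤ (n - r) * r := by
  classical
  have h1 : ∀ l j, (∑ i : Fin (n - r), if (I l j : ℕ) - (j : ℕ) ≤ (i : ℕ) then 1 else 0) =
      (n - r) - ((I l j : ℕ) - (j : ℕ)) := by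
    intro l j
    have := Fin.sum_univ_eq_sum_range (fun i => if (I l j : ℕ) - (j : ℕ) ≤ i then 1 else 0) (n - r)
    rw [this, ← Finset.card_filter]
    have : (Finset.range (n - r)).filter (fun i => (I l j : ℕ) - (j : ℕ) ≤ i) =
      Finset.Ico ((I l j : ℕ) - (j : ℕ)) (n - r) := by
      ext x; simp; omega
    rw [this, Nat.card_Ico]
  rw [Fintype.card_subtype, Finset.card_filter, Fintype.sum_prod_type]
  have h2 : ∀ l : Fin s, (∑ p : Fin (n - r) × Fin r,
      if (I l p.2 : ℕ) - (p.2 : ℕ) ≤ (p.1 : ℕ) then 1 else 0) =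
      ∑ j, ((n - r) - ((I l j : ℕ) - (j : ℕ))) := by
    intro l
    rw [Fintype.sum_prod_type_right]
    exact Finset.sum_congr rfl fun j _ => h1 l j
  simp only [h2]
  zify [hrn]
  unfold edim dimI at hedim
  have h3 : ∀ l : Fin s, ∑ j, ((((n - r) - ((I l j : ℕ) - (j : ℕ)) : ℕ)) : ℤ) =
      (r : ℤ) * ((n : ℤ) - r) - ∑ j, ((I l j : ℤ) - (j : ℤ)) := by
    intro l
    have : ∀ j, ((((n - r) - ((I l j : ℕ) - (j : ℕ)) : ℕ)) : ℤ) =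
      ((n : ℤ) - r) - ((I l j : ℤ) - (j : ℤ)) := by
      intro j
      have := subset_bounds (hI l) j
      omega
    simp only [this]
    rw [Finset.sum_sub_distrib]
    simp
    ring
  simp only [h3]
  linarith

end Algebraic


section Final
open Matrix Topology

lemma exists_surj {s r n : ℕ} (hrn : r ≤ n)
    (I : Fin s → Fin r → Fin n) (hI : ∀ l, StrictMono (I l))
    (hedim : 0 ≤ edim I)
    (hk : kdim r (n - r) (fun l j => (I l j : ℕ)) = 0 ∨
      kdim r (n - r) (fun l j => (I l j : ℕ)) = r) :
    ∃ (a : Fin s → Matrix (Fin r) (Fin r) ℂ) (b b' : Fin s → Matrix (Fin (n - r)) (Fin (n - r)) ℂ),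
      (∀ l, b' l * b l = 1) ∧
      LinearMap.range (maskT (fun l j => (I l j : ℕ) - (j : ℕ)) a b') = ⊤ := by
  classical
  set d : Fin s → Fin r → ℕ := fun l j => (I l j : ℕ) - (j : ℕ) with hd
  set J : Fin s → Fin r → ℕ := fun l j => (I l j : ℕ) with hJ
  have hdq : ∀ l j, d l j ≤ n - r := fun l j => (subset_bounds (hI l) j).2
  have hdm : ∀ l, Monotone (d l) := fun l j j' h => subset_mono (hI l) h
  -- data achieving tdim
  have htd : ∃ (F : Fin s → Flagg r) (G : Fin s → Flagg (n - r)),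
      finrank ℂ (LSpace J F G) = tdim r (n - r) J := by
    have hne : {m : ℕ | ∃ (F : Fin s → Flagg r) (G : Fin s → Flagg (n - r)),
        finrank ℂ (LSpace J F G) = m}.Nonempty :=
      ⟨_, fun _ => (flagg_nonempty r).some, fun _ => (flagg_nonempty (n - r)).some, rfl⟩
    exact Nat.sInf_mem hne
  have hkne : {m : ℕ | ∃ (F : Fin s → Flagg r) (G : Fin s → Flagg (n - r))
      (φ : (Fin r → ℂ) →ₗ[ℂ] (Fin (n - r) → ℂ)), φ ∈ LSpace J F G ∧
      finrank ℂ (LSpace J F G) = tdim r (n - r) J ∧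
      finrank ℂ (LinearMap.ker φ) = m}.Nonempty := by
    obtain ⟨F, G, h⟩ := htd
    exact ⟨_, F, G, 0, Submodule.zero_mem _, h, rfl⟩
  rcases hk with hk | hk
  · -- kdim = 0
    have hmem := Nat.sInf_mem hkne
    obtain ⟨F, G, φ, hφ, htdim, hker⟩ := hmem
    replace hker : finrank ℂ (LinearMap.ker φ) = 0 := hker.trans hk
    choose a a' haa ha using fun l => flag_matrix (F l)
    choose b b' hbb hb using fun l => flag_matrix (G l)
    refine ⟨a, b, b', hbb, ?_⟩
    have hL := mem_LSpace_iff J d (fun _ _ => rfl) hdq hdm F G a b b' ha hbb hb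
    have hfin := finrank_LSpace J d F G a b' hL
    set M := LinearMap.toMatrix' φ with hM
    have hM0 : maskT d a b' M = 0 := (hL φ).1 hφ
    -- left inverse
    obtain ⟨ψ, hψ⟩ := LinearMap.exists_leftInverse_of_injective φ (Submodule.finrank_eq_zero.1 hker)
    set N := LinearMap.toMatrix' ψ with hN
    have hNM : N * M = 1 := by
      rw [hN, hM, ← LinearMap.toMatrix'_comp, hψ, LinearMap.toMatrix'_id]
    -- every perturbation lies in the range
    have hrange : ∀ β : Fin s → Matrix (Fin (n - r)) (Fin (n - r)) ℂ,
        maskT d a (fun l => β l * b' l) M ∈ LinearMap.range (maskT d a b') := by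
      intro β
      by_contra hnot
      have hev := perturb_ker (maskT d a b') (maskT d a (fun l => β l * b' l)) M hM0 hnot
      have hinv : ∀ᶠ t : ℂ in 𝓝[≠] 0, ∀ l, (1 + t • β l).det ≠ 0 := by
        rw [Filter.eventually_all]
        intro l
        have hc : Continuous (fun t : ℂ => (1 + t • β l).det) := by
          apply Continuous.matrix_det
          fun_prop
        have : ∀ᶠ t in 𝓝 (0 : ℂ), (1 + t • β l).det ≠ 0 :=
          hc.continuousAt.eventually_ne (by simp)
        exact this.filter_mono nhdsWithin_le_nhds
      obtain ⟨t, ht1, ht2⟩ := (hev.and hinv).exists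
      have hbt : ∀ l, ((1 + t • β l) * b' l) * (b l * (1 + t • β l)⁻¹) = 1 := by
        intro l
        rw [Matrix.mul_assoc, ← Matrix.mul_assoc (b' l), hbb, Matrix.one_mul,
          Matrix.mul_nonsing_inv _ (isUnit_iff_ne_zero.2 (ht2 l))]
      choose Gt hGt using fun l => flag_of_matrix _ _ (hbt l)
      have hLt := mem_LSpace_iff J d (fun _ _ => rfl) hdq hdm F Gt a _ _ ha hbt hGt
      have hfint := finrank_LSpace J d F Gt a _ hLt
      have heq : maskT d a (fun l => (1 + t • β l) * b' l) =
          maskT d a b' + t • maskT d a (fun l => β l * b' l) := by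
        ext1 η
        funext p
        simp [maskT, Matrix.add_mul]
      rw [heq] at hfint
      have hle : tdim r (n - r) J ≤ finrank ℂ (LSpace J F Gt) := Nat.sInf_le ⟨F, Gt, rfl⟩
      omega
    rw [eq_top_iff]
    intro w _
    let w' : Fin s → Matrix (Fin (n - r)) (Fin r) ℂ := fun l => Matrix.of fun i j =>
      if h : d l j ≤ (i : ℕ) then w ⟨(l, i, j), h⟩ else 0
    have := hrange (fun l => w' l * a' l * N * b l)
    convert this using 1
    ext ⟨⟨l, i, j⟩, hp⟩
    have h1 : (w' l * a' l * N * b l) * b' l * M * a l = w' l := by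
      have hb' : b l * b' l = 1 := mul_eq_one_comm.mp (hbb l)
      calc (w' l * a' l * N * b l) * b' l * M * a l
          = w' l * a' l * N * (b l * b' l) * M * a l := by simp only [Matrix.mul_assoc]
        _ = w' l * a' l * (N * M) * a l := by rw [hb']; simp only [Matrix.mul_assoc, Matrix.one_mul]
        _ = w' l := by rw [hNM, Matrix.mul_one, Matrix.mul_assoc, haa, Matrix.mul_one]
    show _ = ((w' l * a' l * N * b l) * b' l * M * a l) i j
    rw [h1]
    have hp' : d l j ≤ (i : ℕ) := hp
    simp [w', hp']
  · -- kdim = r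
    obtain ⟨F, G, htdim⟩ := htd
    choose a a' haa ha using fun l => flag_matrix (F l)
    choose b b' hbb hb using fun l => flag_matrix (G l)
    refine ⟨a, b, b', hbb, ?_⟩
    have hL := mem_LSpace_iff J d (fun _ _ => rfl) hdq hdm F G a b b' ha hbb hb
    have hinj : LinearMap.ker (maskT d a b') = ⊥ := by
      rw [LinearMap.ker_eq_bot']
      intro η hη
      have hφ : Matrix.toLin' η ∈ LSpace J F G := by
        rw [hL, LinearMap.toMatrix'_toLin']; exact hη
      have h1 : r ≤ finrank ℂ (LinearMap.ker (Matrix.toLin' η)) := by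
        calc r = kdim r (n - r) J := hk.symm
          _ ≤ _ := Nat.sInf_le ⟨F, G, _, hφ, htdim, rfl⟩
      have h2 : LinearMap.ker (Matrix.toLin' η) = ⊤ := by
        apply Submodule.eq_top_of_finrank_eq
        have := Submodule.finrank_le (LinearMap.ker (Matrix.toLin' η))
        simp at this ⊢
        omega
      have h3 : Matrix.toLin' η = 0 := LinearMap.ker_eq_top.1 h2
      simpa using h3
    apply Submodule.eq_top_of_finrank_eq
    apply le_antisymm (Submodule.finrank_le _)
    have h4 := LinearMap.finrank_range_add_finrank_ker (maskT d a b')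
    rw [hinj, finrank_bot, Module.finrank_matrix] at h4
    have h5 := card_mask hrn I hI hedim
    rw [Module.finrank_fintype_fun_eq_card]
    simp at h4
    rw [h4]
    exact h5

end Final

/-- If `edim 𝐈 ≥ 0` and `kdim 𝐈 ∈ {0, r}` then `𝐈` is intersecting. -/
theorem intersecting_of_kdim (s r n : ℕ) (hs : 2 ≤ s) (hr : 1 ≤ r) (hrn : r ≤ n)
    (I : Fin s → Fin r → Fin n) (hI : ∀ l, StrictMono (I l))
    (hedim : 0 ≤ edim I)
    (hk : kdim r (n - r) (fun l j => (I l j : ℕ)) = 0 ∨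
      kdim r (n - r) (fun l j => (I l j : ℕ)) = r) :
    Intersecting I := by
  obtain ⟨a, b, b', hbb, hT⟩ := exists_surj hrn I hI hedim hk
  refine intersecting_of_surj hrn I hI a b b' (fun l => mul_eq_one_comm.mp (hbb l)) ?_
  intro w
  obtain ⟨η, hη⟩ := LinearMap.range_eq_top.1 hT (fun p => w p.1.1 p.1.2.1 p.1.2.2)
  exact ⟨η, fun l i j h => congrFun hη ⟨(l, i, j), h⟩⟩
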